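/- arXiv:1709.01983 — 3 statements merged into one kernel-verified Lean document; each statement's English description precedes it below -/
import Mathlib

section
/- Let α ≥ 4 be a real number, let φ_α(ξ) = ξ|ξ|^α, and for ξ₁, ξ₂ ∈ ℝ with ξ = ξ₁ + ξ₂ set r_α(ξ, ξ₁) = φ_α(ξ) − φ_α(ξ₁) − φ_α(ξ₂). Then there exist constants c, C > 0 depending only on α such that for all ξ₁, ξ₂ ∈ ℝ: c · |ξ_min| · |ξ_max|^α ≤ |r_α(ξ, ξ₁)| ≤ C · |ξ_min| · |ξ_max|^α, where |ξ_min| = min{|ξ|, |ξ₁|, |ξ₂|} and |ξ_max| = max{|ξ|, |ξ₁|, |ξ₂|}. (Paper's Lemma 2.8.) -/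
/-- The frequencies `ξ₁`, `ξ₂` satisfy the two-sided resonance bound with constants `c` and `C`. -/
def ResonanceBound (α c C ξ₁ ξ₂ : ℝ) : Prop :=
  c * min |ξ₁ + ξ₂| (min |ξ₁| |ξ₂|) * max |ξ₁ + ξ₂| (max |ξ₁| |ξ₂|) ^ α ≤
      abs ((ξ₁ + ξ₂) * |ξ₁ + ξ₂| ^ α - ξ₁ * |ξ₁| ^ α - ξ₂ * |ξ₂| ^ α) ∧
    abs ((ξ₁ + ξ₂) * |ξ₁ + ξ₂| ^ α - ξ₁ * |ξ₁| ^ α - ξ₂ * |ξ₂| ^ α) ≤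
      C * min |ξ₁ + ξ₂| (min |ξ₁| |ξ₂|) * max |ξ₁ + ξ₂| (max |ξ₁| |ξ₂|) ^ α

namespace ResonanceBound

variable {α c C x y : ℝ}

theorem symm (h : ResonanceBound α c C x y) : ResonanceBound α c C y x := by
  unfold ResonanceBound at *
  rwa [add_comm y x, min_comm |y|, max_comm |y|, sub_right_comm]

theorem neg (h : ResonanceBound α c C x y) : ResonanceBound α c C (-x) (-y) := by
  unfold ResonanceBound at *
  have e : (-x + -y) * |x + y| ^ α - -x * |x| ^ α - -y * |y| ^ α =
      -((x + y) * |x + y| ^ α - x * |x| ^ α - y * |y| ^ α) := by ring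
  have e' : |-x + -y| = |x + y| := by rw [← neg_add, abs_neg]
  rwa [e', abs_neg x, abs_neg y, e, abs_neg]

theorem of_add_neg (h : ResonanceBound α c C (x + y) (-y)) : ResonanceBound α c C x y := by
  unfold ResonanceBound at *
  have e : x * |x| ^ α - (x + y) * |x + y| ^ α - -y * |y| ^ α =
      -((x + y) * |x + y| ^ α - x * |x| ^ α - y * |y| ^ α) := by ring
  rwa [add_neg_cancel_right, abs_neg y, e, abs_neg, min_left_comm, max_left_comm] at h

theorem of_nonneg_of_le (hα : 1 ≤ α) (hx : 0 ≤ x) (hxy : x ≤ y) :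
    ResonanceBound α (1 / 2) (1 + α) x y := by
  have hy : 0 ≤ y := hx.trans hxy
  have hs : 0 ≤ x + y := add_nonneg hx hy
  unfold ResonanceBound
  rw [abs_of_nonneg hx, abs_of_nonneg hy, abs_of_nonneg hs, min_eq_left hxy, max_eq_right hxy,
    min_eq_right (by linarith), max_eq_left (by linarith)]
  rcases hs.eq_or_lt with h0 | hpos
  · have hx0 : x = 0 := by linarith
    have hy0 : y = 0 := by linarith
    simp [hx0, hy0]
  have hS : 0 ≤ (x + y) ^ α := by positivity
  have hX : x ^ α ≤ 1 / 2 * (x + y) ^ α := by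
    calc x ^ α ≤ (1 / 2 * (x + y)) ^ α := by
          apply Real.rpow_le_rpow hx <;> linarith
      _ = (1 / 2 : ℝ) ^ α * (x + y) ^ α := Real.mul_rpow (by norm_num) hs
      _ ≤ 1 / 2 * (x + y) ^ α := by
          gcongr
          simpa using Real.rpow_le_rpow_of_exponent_ge (x := 1 / 2) (by norm_num) (by norm_num) hα
  have hY : y ^ α ≤ (x + y) ^ α := Real.rpow_le_rpow hy (by linarith) (by linarith)
  have hX0 : 0 ≤ x ^ α := by positivity
  have hB : y * ((x + y) ^ α - y ^ α) ≤ α * x * (x + y) ^ α := by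
    have hq : x / (x + y) ≤ 1 := (div_le_one hpos).2 (by linarith)
    have h1 := one_add_mul_self_le_rpow_one_add (s := -(x / (x + y))) (by linarith) hα
    have h2 : (1 + -(x / (x + y))) * (x + y) = y := by field_simp; ring
    have h3 : (1 + -(x / (x + y))) ^ α * (x + y) ^ α = y ^ α := by
      rw [← Real.mul_rpow (by linarith) hs, h2]
    have h4 := mul_le_mul_of_nonneg_right h1 hS
    rw [h3] at h4
    calc y * ((x + y) ^ α - y ^ α)
        ≤ (x + y) * (α * (x / (x + y)) * (x + y) ^ α) :=
          mul_le_mul (by linarith) (by linarith) (by linarith) hs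
      _ = α * x * (x + y) ^ α := by field_simp
  have hlow : 1 / 2 * x * (x + y) ^ α ≤ (x + y) * (x + y) ^ α - x * x ^ α - y * y ^ α := by
    nlinarith [mul_le_mul_of_nonneg_left hX hx, mul_le_mul_of_nonneg_left hY hy]
  rw [abs_of_nonneg (le_trans (by positivity) hlow)]
  exact ⟨hlow, by nlinarith [mul_nonneg hx hX0]⟩

theorem of_nonneg (hα : 1 ≤ α) (hx : 0 ≤ x) (hy : 0 ≤ y) :
    ResonanceBound α (1 / 2) (1 + α) x y := by
  rcases le_total x y with h | h
  · exact of_nonneg_of_le hα hx h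
  · exact (of_nonneg_of_le hα hy h).symm

theorem of_add_nonneg (hα : 1 ≤ α) (hxy : 0 ≤ x + y) :
    ResonanceBound α (1 / 2) (1 + α) x y := by
  rcases le_total 0 y with hy | hy
  · rcases le_total 0 x with hx | hx
    · exact of_nonneg hα hx hy
    · refine (of_add_neg ?_).symm
      exact of_nonneg hα (by linarith) (by linarith)
  · exact of_add_neg (of_nonneg hα hxy (by linarith))

theorem of_one_le (hα : 1 ≤ α) (x y : ℝ) : ResonanceBound α (1 / 2) (1 + α) x y := by
  rcases le_total 0 (x + y) with h | h
  · exact of_add_nonneg hα h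
  · simpa using (of_add_nonneg hα (x := -x) (y := -y) (by linarith)).neg

end ResonanceBound

/-- **Paper's Lemma 2.8.**
Let `α ≥ 4`, `φ_α(ξ) = ξ|ξ|^α`, and for `ξ = ξ₁ + ξ₂` set
`r_α(ξ, ξ₁) = φ_α(ξ) − φ_α(ξ₁) − φ_α(ξ₂)`.  Then there are constants `c, C > 0`
depending only on `α` with
`c |ξ_min| |ξ_max|^α ≤ |r_α(ξ, ξ₁)| ≤ C |ξ_min| |ξ_max|^α`. -/
theorem stmt5 (α : ℝ) (hα : 4 ≤ α) :
    ∃ c C : ℝ, 0 < c ∧ 0 < C ∧ ∀ ξ₁ ξ₂ : ℝ,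
      c * min |ξ₁ + ξ₂| (min |ξ₁| |ξ₂|) * max |ξ₁ + ξ₂| (max |ξ₁| |ξ₂|) ^ α ≤
          abs ((ξ₁ + ξ₂) * |ξ₁ + ξ₂| ^ α - ξ₁ * |ξ₁| ^ α - ξ₂ * |ξ₂| ^ α) ∧
        abs ((ξ₁ + ξ₂) * |ξ₁ + ξ₂| ^ α - ξ₁ * |ξ₁| ^ α - ξ₂ * |ξ₂| ^ α) ≤
          C * min |ξ₁ + ξ₂| (min |ξ₁| |ξ₂|) * max |ξ₁ + ξ₂| (max |ξ₁| |ξ₂|) ^ α := by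
  exact ⟨1 / 2, 1 + α, by norm_num, by linarith,
    ResonanceBound.of_one_le (by linarith)⟩
end

section
/- Let α ≥ 4 be real, let ξ₁, ξ₂ be nonzero reals with ξ := ξ₁ + ξ₂ ≠ 0, and let μ₁, μ₂ ∈ ℝ. Set Δ = ξ|ξ|^α − ξ₁|ξ₁|^α − ξ₂|ξ₂|^α and define the KP-II resonance function R_II(ξ₁, ξ₂, μ₁, μ₂) = Δ + (ξ₁ξ₂/ξ) · (μ₁/ξ₁ − μ₂/ξ₂)². Then Δ has the same sign as ξ·ξ₁·ξ₂ (i.e. Δ · (ξ ξ₁ ξ₂) ≥ 0), and consequently |R_II(ξ₁, ξ₂, μ₁, μ₂)| ≥ |ξ|ξ|^α − ξ₁|ξ₁|^α − ξ₂|ξ₂|^α|. (Paper's inequality (1.08) with the underlying sign claim.) -/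
/-- The function `x ↦ x * |x| ^ α` is superadditive on the nonnegative reals. -/
theorem mul_abs_rpow_add_le {α : ℝ} (hα : 0 ≤ α) {a b : ℝ} (ha : 0 ≤ a) (hb : 0 ≤ b) :
    a * |a| ^ α + b * |b| ^ α ≤ (a + b) * |a + b| ^ α := by
  rw [abs_of_nonneg ha, abs_of_nonneg hb, abs_of_nonneg (add_nonneg ha hb), add_mul]
  gcongr <;> linarith

/-- If `x + y + z = 0`, the sum of `t * |t| ^ α` over `x, y, z` has the sign of `x * y * z` when
`x` and `y` are nonnegative. -/
theorem sum_mul_abs_rpow_mul_nonneg_of_nonneg {α : ℝ} (hα : 0 ≤ α) {x y z : ℝ}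
    (h : x + y + z = 0) (hx : 0 ≤ x) (hy : 0 ≤ y) :
    0 ≤ (x * |x| ^ α + y * |y| ^ α + z * |z| ^ α) * (x * y * z) := by
  have key := mul_abs_rpow_add_le hα hx hy
  obtain rfl : z = -(x + y) := by linarith
  rw [abs_neg]
  exact mul_nonneg_of_nonpos_of_nonpos (by linarith)
    (mul_nonpos_of_nonneg_of_nonpos (mul_nonneg hx hy) (by linarith))

/-- If `x + y + z = 0`, the sum of `t * |t| ^ α` over `x, y, z` has the sign of `x * y * z` when
`x` and `y` have the same sign. -/
theorem sum_mul_abs_rpow_mul_nonneg_of_mul_nonneg {α : ℝ} (hα : 0 ≤ α) {x y z : ℝ}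
    (h : x + y + z = 0) (hxy : 0 ≤ x * y) :
    0 ≤ (x * |x| ^ α + y * |y| ^ α + z * |z| ^ α) * (x * y * z) := by
  rcases mul_nonneg_iff.mp hxy with ⟨hx, hy⟩ | ⟨hx, hy⟩
  · exact sum_mul_abs_rpow_mul_nonneg_of_nonneg hα h hx hy
  · have key := sum_mul_abs_rpow_mul_nonneg_of_nonneg hα (x := -x) (y := -y) (z := -z)
      (by linarith) (by linarith) (by linarith)
    simp only [abs_neg] at key
    linarith

/-- If `x + y + z = 0`, the sum of `t * |t| ^ α` over `x, y, z` has the sign of `x * y * z`. -/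
theorem sum_mul_abs_rpow_mul_nonneg {α : ℝ} (hα : 0 ≤ α) {x y z : ℝ} (h : x + y + z = 0) :
    0 ≤ (x * |x| ^ α + y * |y| ^ α + z * |z| ^ α) * (x * y * z) := by
  rcases le_or_gt 0 (x * y) with hxy | hxy
  · exact sum_mul_abs_rpow_mul_nonneg_of_mul_nonneg hα h hxy
  rcases le_or_gt 0 (y * z) with hyz | hyz
  · linarith [sum_mul_abs_rpow_mul_nonneg_of_mul_nonneg hα (z := x) (by linarith) hyz]
  have hzx : 0 ≤ z * x := by
    by_contra! hzx
    nlinarith [mul_pos_of_neg_of_neg hxy hyz, sq_nonneg y]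
  linarith [sum_mul_abs_rpow_mul_nonneg_of_mul_nonneg hα (z := y) (by linarith) hzx]

theorem abs_le_abs_add_of_mul_nonneg {a b : ℝ} (h : 0 ≤ a * b) : |a| ≤ |a + b| :=
  sq_le_sq.mp (by nlinarith [sq_nonneg b])


/-- **Paper's inequality (1.08) with the underlying sign claim.**
For `α ≥ 4`, nonzero `ξ₁, ξ₂` with `ξ = ξ₁ + ξ₂ ≠ 0`, and
`Δ = ξ|ξ|^α − ξ₁|ξ₁|^α − ξ₂|ξ₂|^α`, the quantity `Δ` has the same sign as `ξ ξ₁ ξ₂`,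
and consequently the KP-II resonance function
`R_II = Δ + (ξ₁ξ₂/ξ)(μ₁/ξ₁ − μ₂/ξ₂)²` satisfies `|R_II| ≥ |Δ|`. -/
theorem stmt7 (α : ℝ) (hα : 4 ≤ α) (ξ₁ ξ₂ μ₁ μ₂ : ℝ)
    (h1 : ξ₁ ≠ 0) (h2 : ξ₂ ≠ 0) (h : ξ₁ + ξ₂ ≠ 0) :
    0 ≤ ((ξ₁ + ξ₂) * |ξ₁ + ξ₂| ^ α - ξ₁ * |ξ₁| ^ α - ξ₂ * |ξ₂| ^ α) *
        ((ξ₁ + ξ₂) * ξ₁ * ξ₂) ∧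
      abs ((ξ₁ + ξ₂) * |ξ₁ + ξ₂| ^ α - ξ₁ * |ξ₁| ^ α - ξ₂ * |ξ₂| ^ α) ≤
        abs (((ξ₁ + ξ₂) * |ξ₁ + ξ₂| ^ α - ξ₁ * |ξ₁| ^ α - ξ₂ * |ξ₂| ^ α) +
          ξ₁ * ξ₂ / (ξ₁ + ξ₂) * (μ₁ / ξ₁ - μ₂ / ξ₂) ^ 2) := by
  have sign : 0 ≤ ((ξ₁ + ξ₂) * |ξ₁ + ξ₂| ^ α - ξ₁ * |ξ₁| ^ α - ξ₂ * |ξ₂| ^ α) *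
      ((ξ₁ + ξ₂) * ξ₁ * ξ₂) := by
    have key := sum_mul_abs_rpow_mul_nonneg (by linarith : 0 ≤ α) (add_neg_cancel (ξ₁ + ξ₂))
    rw [abs_neg] at key
    linarith
  refine ⟨sign, abs_le_abs_add_of_mul_nonneg ?_⟩
  have factor : ξ₁ * ξ₂ / (ξ₁ + ξ₂) * (μ₁ / ξ₁ - μ₂ / ξ₂) ^ 2 =
      (ξ₁ + ξ₂) * ξ₁ * ξ₂ * ((μ₁ / ξ₁ - μ₂ / ξ₂) / (ξ₁ + ξ₂)) ^ 2 := by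
    generalize μ₁ / ξ₁ - μ₂ / ξ₂ = m
    field_simp
  rw [factor, ← mul_assoc]
  exact mul_nonneg sign (sq_nonneg _)
end

section
/- Let α ≥ 4 be real and b > 1/2. There exists C > 0 (depending only on α and b) such that for all nonnegative f, f₁, f₂ ∈ L²(ℝ³): ∫ över the set of (ξ₁, μ₁, τ₁, ξ, μ, τ) ∈ ℝ⁶ with ξ₁ ≠ 0, ξ ≠ 0, ξ₂ := ξ − ξ₁ ≠ 0, |ξ₁| ≤ |ξ₂|/4, and |σ − σ₁ − σ₂| ≥ |Δ|/α, of the integrand |ξ₁|^{-1/2} |ξ₂|^{α/4} ⟨σ₁⟩^{-b} ⟨σ₂⟩^{-b} f(ξ, μ, τ) f₁(ξ₁, μ₁, τ₁) f₂(ξ₂, μ₂, τ₂), is at most C ‖f‖_{L²} ‖f₁‖_{L²} ‖f₂‖_{L²}. Here (μ₂, τ₂) = (μ − μ₁, τ − τ₁), σ = τ + φ(ξ, μ), σⱼ = τⱼ + φ(ξⱼ, μⱼ), and Δ = ξ|ξ|^α − ξ₁|ξ₁|^α − ξ₂|ξ₂|^α. (Paper's Lemma 2.4 in its equivalent dual integral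 form (2.010).) -/
open MeasureTheory

/-- The generalized KP-I dispersion relation `φ(ξ, μ) = ξ|ξ|^α + μ²/ξ`. -/
noncomputable def phi (α ξ μ : ℝ) : ℝ := ξ * |ξ| ^ α + μ ^ 2 / ξ

/-- The modulation `σ = τ + φ(ξ, μ)` of a point `p = (ξ, μ, τ)`. -/
noncomputable def sigma (α : ℝ) (p : ℝ × ℝ × ℝ) : ℝ := p.2.2 + phi α p.1 p.2.1

/-- Componentwise difference of two frequency-space points. -/
def sub3 (q p : ℝ × ℝ × ℝ) : ℝ × ℝ × ℝ := (q.1 - p.1, q.2.1 - p.2.1, q.2.2 - p.2.2)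

/-- `Δ = ξ|ξ|^α − ξ₁|ξ₁|^α − ξ₂|ξ₂|^α` with `ξ₂ = ξ − ξ₁`. -/
noncomputable def res (α ξ ξ₁ : ℝ) : ℝ :=
  ξ * |ξ| ^ α - ξ₁ * |ξ₁| ^ α - (ξ - ξ₁) * |ξ - ξ₁| ^ α

open Set

lemma lintegral_abs_rpow_neg_half_le {R : ℝ} (hR : 0 ≤ R) :
    ∫⁻ t in {t : ℝ | |t| ≤ R}, ENNReal.ofReal (|t| ^ (-(1 : ℝ) / 2)) ≤
      ENNReal.ofReal (4 * R ^ ((1 : ℝ) / 2)) := by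
  have half : ∫⁻ t in Icc 0 R, ENNReal.ofReal (|t| ^ (-(1 : ℝ) / 2)) =
      ENNReal.ofReal (2 * R ^ ((1 : ℝ) / 2)) := by
    rw [← restrict_Ioc_eq_restrict_Icc]
    have hint : IntegrableOn (fun t : ℝ => |t| ^ (-(1 : ℝ) / 2)) (Ioc 0 R) := by
      have h := (intervalIntegral.intervalIntegrable_rpow' (a := 0) (b := R)
        (r := -(1 : ℝ) / 2) (by norm_num)).1
      refine h.congr_fun (fun t ht => ?_) measurableSet_Ioc
      simp only [abs_of_pos ht.1]
    rw [← ofReal_integral_eq_lintegral_ofReal hint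
      (Filter.Eventually.of_forall fun t => by positivity)]
    congr 1
    have : ∫ t in Ioc 0 R, |t| ^ (-(1 : ℝ) / 2) = ∫ t in Ioc 0 R, t ^ (-(1 : ℝ) / 2) :=
      setIntegral_congr_fun measurableSet_Ioc fun t ht => by simp only [abs_of_pos ht.1]
    rw [this, ← intervalIntegral.integral_of_le hR, integral_rpow (by left; norm_num)]
    have h2 : (-(1 : ℝ) / 2 + 1) = 1 / 2 := by norm_num
    rw [h2, Real.zero_rpow (by norm_num)]
    ring
  have hneg : ∫⁻ t in Icc (-R) 0, ENNReal.ofReal (|t| ^ (-(1 : ℝ) / 2)) =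
      ∫⁻ t in Icc 0 R, ENNReal.ofReal (|t| ^ (-(1 : ℝ) / 2)) := by
    rw [← lintegral_indicator measurableSet_Icc, ← lintegral_indicator measurableSet_Icc,
      ← lintegral_neg_eq_self]
    refine lintegral_congr fun t => ?_
    have : -t ∈ Icc (-R) 0 ↔ t ∈ Icc 0 R := by
      simp only [mem_Icc]; constructor <;> rintro ⟨h1, h2⟩ <;> constructor <;> linarith
    by_cases h : t ∈ Icc 0 R
    · rw [indicator_of_mem h, indicator_of_mem (this.2 h), abs_neg]
    · rw [indicator_of_notMem h, indicator_of_notMem (mt this.1 h)]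
  have hsub : {t : ℝ | |t| ≤ R} ⊆ Icc (-R) 0 ∪ Icc 0 R := by
    intro t ht
    have := abs_le.1 (show |t| ≤ R from ht)
    rcases le_total t 0 with h | h
    · exact Or.inl ⟨this.1, h⟩
    · exact Or.inr ⟨h, this.2⟩
  calc _ ≤ ∫⁻ t in Icc (-R) 0 ∪ Icc 0 R, ENNReal.ofReal (|t| ^ (-(1 : ℝ) / 2)) :=
        lintegral_mono_set hsub
    _ ≤ _ := lintegral_union_le _ _ _
    _ = _ := by
        rw [hneg, half, ← ENNReal.ofReal_add (by positivity) (by positivity)]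
        congr 1; ring

/-- The Beta-type integral `∫ |s|^{-1/2} |s - m|^{-1/2}` over `|s| ≤ α |m|` is bounded
uniformly in `m`. -/
lemma lintegral_two_singularities_le {α : ℝ} (hα : 0 ≤ α) (m : ℝ) :
    ∫⁻ s in {s : ℝ | |s| ≤ α * |m|},
        ENNReal.ofReal (|s| ^ (-(1 : ℝ) / 2) * |s - m| ^ (-(1 : ℝ) / 2)) ≤
      ENNReal.ofReal (8 * (2 * (α + 1)) ^ ((1 : ℝ) / 2)) := by
  rcases eq_or_ne m 0 with rfl | hm
  · have : {s : ℝ | |s| ≤ α * |0|} ⊆ {0} := by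
      intro s hs
      simpa using hs
    refine (lintegral_mono_set this).trans ?_
    simp
  have hm' : 0 < |m| := abs_pos.2 hm
  set k : ℝ := (|m| / 2) ^ (-(1 : ℝ) / 2) with hk
  set R : ℝ := (α + 1) * |m| with hR
  have hk0 : 0 ≤ k := by positivity
  have hR0 : 0 ≤ R := by positivity
  have hpt : ∀ s : ℝ, |s| ^ (-(1 : ℝ) / 2) * |s - m| ^ (-(1 : ℝ) / 2) ≤
      k * (|s| ^ (-(1 : ℝ) / 2) + |s - m| ^ (-(1 : ℝ) / 2)) := by
    intro s
    have hs0 : 0 ≤ |s| ^ (-(1 : ℝ) / 2) := by positivity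
    have hs1 : 0 ≤ |s - m| ^ (-(1 : ℝ) / 2) := by positivity
    rcases le_total (|m| / 2) |s| with h | h
    · have : |s| ^ (-(1 : ℝ) / 2) ≤ k :=
        Real.rpow_le_rpow_of_nonpos (by positivity) h (by norm_num)
      nlinarith [mul_le_mul_of_nonneg_right this hs1, mul_nonneg hk0 hs0]
    · have h' : |m| / 2 ≤ |s - m| := by
        have := abs_sub_abs_le_abs_sub m s
        rw [abs_sub_comm] at this
        linarith
      have : |s - m| ^ (-(1 : ℝ) / 2) ≤ k :=
        Real.rpow_le_rpow_of_nonpos (by positivity) h' (by norm_num)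
      nlinarith [mul_le_mul_of_nonneg_left this hs0, mul_nonneg hk0 hs1]
  have h1 : ∫⁻ s in {s : ℝ | |s| ≤ α * |m|}, ENNReal.ofReal (|s| ^ (-(1 : ℝ) / 2)) ≤
      ENNReal.ofReal (4 * R ^ ((1 : ℝ) / 2)) :=
    (lintegral_mono_set fun s (hs : |s| ≤ _) => by
      show |s| ≤ R
      nlinarith).trans (lintegral_abs_rpow_neg_half_le hR0)
  have h2 : ∫⁻ s in {s : ℝ | |s| ≤ α * |m|}, ENNReal.ofReal (|s - m| ^ (-(1 : ℝ) / 2)) ≤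
      ENNReal.ofReal (4 * R ^ ((1 : ℝ) / 2)) := by
    have hms : MeasurableSet {s : ℝ | |s - m| ≤ R} :=
      measurableSet_le (by fun_prop) (by fun_prop)
    have hms' : MeasurableSet {s : ℝ | |s| ≤ R} :=
      measurableSet_le (by fun_prop) (by fun_prop)
    calc _ ≤ ∫⁻ s in {s : ℝ | |s - m| ≤ R}, ENNReal.ofReal (|s - m| ^ (-(1 : ℝ) / 2)) :=
          lintegral_mono_set fun s (hs : |s| ≤ _) => by
            show |s - m| ≤ R
            have := abs_sub s m
            nlinarith
      _ = ∫⁻ s in {s : ℝ | |s| ≤ R}, ENNReal.ofReal (|s| ^ (-(1 : ℝ) / 2)) := by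
          rw [← lintegral_indicator hms, ← lintegral_indicator hms',
            ← lintegral_sub_right_eq_self ({s : ℝ | |s| ≤ R}.indicator _) m]
          rfl
      _ ≤ _ := lintegral_abs_rpow_neg_half_le hR0
  calc _ ≤ ∫⁻ s in {s : ℝ | |s| ≤ α * |m|}, ENNReal.ofReal k *
          (ENNReal.ofReal (|s| ^ (-(1 : ℝ) / 2)) + ENNReal.ofReal (|s - m| ^ (-(1 : ℝ) / 2))) := by
        refine lintegral_mono fun s => ?_
        rw [← ENNReal.ofReal_add (by positivity) (by positivity), ← ENNReal.ofReal_mul hk0]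
        exact ENNReal.ofReal_le_ofReal (hpt s)
    _ = ENNReal.ofReal k *
          ((∫⁻ s in {s : ℝ | |s| ≤ α * |m|}, ENNReal.ofReal (|s| ^ (-(1 : ℝ) / 2))) +
          ∫⁻ s in {s : ℝ | |s| ≤ α * |m|}, ENNReal.ofReal (|s - m| ^ (-(1 : ℝ) / 2))) := by
        rw [lintegral_const_mul' _ _ ENNReal.ofReal_ne_top, lintegral_add_left (by fun_prop)]
    _ ≤ ENNReal.ofReal k *
          (ENNReal.ofReal (4 * R ^ ((1 : ℝ) / 2)) + ENNReal.ofReal (4 * R ^ ((1 : ℝ) / 2))) := by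
        gcongr
    _ = _ := by
        rw [← ENNReal.ofReal_add (by positivity) (by positivity), ← ENNReal.ofReal_mul hk0]
        congr 1
        have e1 : R = (2 * (α + 1)) * (|m| / 2) := by rw [hR]; ring
        have e2 : k * (|m| / 2) ^ ((1 : ℝ) / 2) = 1 := by
          rw [hk, ← Real.rpow_add (by positivity)]; norm_num
        rw [e1, Real.mul_rpow (by positivity) (by positivity)]
        linear_combination (8 * (2 * (α + 1)) ^ ((1 : ℝ) / 2)) * e2

lemma hasDerivAt_mul_abs_rpow {α : ℝ} (hα : 1 < α) (x : ℝ) :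
    HasDerivAt (fun x : ℝ => x * |x| ^ α) ((α + 1) * |x| ^ α) x := by
  have h := (hasDerivAt_id x).mul (hasDerivAt_abs_rpow x hα)
  refine h.congr_deriv ?_
  rcases eq_or_ne x 0 with rfl | hx
  · simp [Real.zero_rpow (by linarith : α ≠ 0)]
  · have hx' : 0 < |x| := abs_pos.2 hx
    have : |x| ^ α = |x| ^ (α - 2) * (x * x) := by
      rw [← abs_mul_abs_self x, ← pow_two, ← Real.rpow_natCast, ← Real.rpow_add hx']
      norm_num
    simp only [id]
    rw [this]; ring

lemma hasDerivAt_res {α : ℝ} (hα : 1 < α) (ξ x : ℝ) :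
    HasDerivAt (res α ξ) ((α + 1) * (|ξ - x| ^ α - |x| ^ α)) x := by
  have h1 := hasDerivAt_mul_abs_rpow hα x
  have h2 := (hasDerivAt_mul_abs_rpow hα (ξ - x)).comp x ((hasDerivAt_id x).const_sub ξ)
  have h := (h1.const_sub (ξ * |ξ| ^ α)).sub h2
  refine h.congr_deriv ?_
  ring

lemma continuous_res {α : ℝ} (hα : 1 < α) (ξ : ℝ) : Continuous (res α ξ) :=
  continuous_iff_continuousAt.2 fun x => (hasDerivAt_res hα ξ x).continuousAt

lemma abs_rpow_le_deriv_res {α ξ x : ℝ} (hα : 4 ≤ α) (hx : |x| ≤ |ξ| / 3) :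
    |ξ - x| ^ α ≤ (α + 1) * (|ξ - x| ^ α - |x| ^ α) := by
  have h1 : |x| ≤ |ξ - x| / 2 := by
    have := abs_sub_abs_le_abs_sub ξ x
    linarith
  have h2 : |x| ^ α ≤ (|ξ - x| / 2) ^ α := by gcongr
  rw [Real.div_rpow (abs_nonneg _) (by norm_num)] at h2
  have h3 : (2 : ℝ) ≤ 2 ^ α := by
    calc (2 : ℝ) = 2 ^ (1 : ℝ) := by norm_num
      _ ≤ 2 ^ α := Real.rpow_le_rpow_of_exponent_le (by norm_num) (by linarith)
  have h4 : |ξ - x| ^ α / 2 ^ α ≤ |ξ - x| ^ α / 2 := by gcongr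
  have h5 : 0 ≤ |ξ - x| ^ α := by positivity
  nlinarith

lemma injOn_res {α ξ : ℝ} (hα : 4 ≤ α) (hξ : ξ ≠ 0) :
    InjOn (res α ξ) {x | |x| ≤ |ξ| / 3} := by
  have hset : {x : ℝ | |x| ≤ |ξ| / 3} = Icc (-(|ξ| / 3)) (|ξ| / 3) := by
    ext x; simp [abs_le]
  rw [hset]
  refine (strictMonoOn_of_deriv_pos (convex_Icc _ _)
    (continuous_res (by linarith) ξ).continuousOn fun x hx => ?_).injOn
  rw [(hasDerivAt_res (by linarith) ξ x).deriv]
  have hx' : |x| ≤ |ξ| / 3 := abs_le.2 (mem_Icc.1 (interior_subset hx))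
  refine lt_of_lt_of_le ?_ (abs_rpow_le_deriv_res hα hx')
  have := abs_sub_abs_le_abs_sub ξ x
  have := abs_pos.2 hξ
  exact Real.rpow_pos_of_pos (by linarith) _

lemma res_zero_right {α : ℝ} (ξ : ℝ) : res α ξ 0 = 0 := by simp [res]

lemma abs_res_le {α ξ x : ℝ} (hα : 4 ≤ α) (hx : |x| ≤ |ξ| / 3) :
    |res α ξ x| ≤ (α + 1) * 2 ^ α * (|x| * |ξ - x| ^ α) := by
  have h23 : |ξ| * (2 / 3) ≤ |ξ - x| := by
    have := abs_sub_abs_le_abs_sub ξ x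
    linarith
  have hbound : ∀ y ∈ Icc (-(|ξ| / 3)) (|ξ| / 3),
      ‖(α + 1) * (|ξ - y| ^ α - |y| ^ α)‖ ≤ (α + 1) * 2 ^ α * |ξ - x| ^ α := by
    intro y hy
    have hy' : |y| ≤ |ξ| / 3 := abs_le.2 hy
    have hpos : 0 ≤ (α + 1) * (|ξ - y| ^ α - |y| ^ α) :=
      le_trans (by positivity) (abs_rpow_le_deriv_res hα hy')
    rw [Real.norm_of_nonneg hpos, mul_assoc, ← Real.mul_rpow (by norm_num) (abs_nonneg _)]
    have h1 : |ξ - y| ≤ 2 * |ξ - x| := by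
      have := abs_sub ξ y
      linarith
    have h2 : |ξ - y| ^ α ≤ (2 * |ξ - x|) ^ α := by gcongr
    have h3 : 0 ≤ |y| ^ α := by positivity
    gcongr
    linarith
  have h := Convex.norm_image_sub_le_of_norm_hasDerivWithin_le
    (fun y _ => (hasDerivAt_res (by linarith : 1 < α) ξ y).hasDerivWithinAt) hbound
    (convex_Icc _ _) (x := 0) (y := x) ⟨by linarith [abs_nonneg ξ], by positivity⟩ (abs_le.1 hx)
  rw [res_zero_right, sub_zero, sub_zero, Real.norm_eq_abs, Real.norm_eq_abs] at h
  linarith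

/-- Uniform bound for the `ξ₁`-integral, via the substitution `s = res α ξ ξ₁`. -/
lemma lintegral_res_le {α ξ : ℝ} (hα : 4 ≤ α) (hξ : ξ ≠ 0) (m : ℝ) :
    ∫⁻ x in {x : ℝ | x ≠ 0 ∧ |x| ≤ |ξ| / 3 ∧ |res α ξ x| ≤ α * |m|},
        ENNReal.ofReal (|x| ^ (-(1 : ℝ) / 2) * |ξ - x| ^ (α / 2) *
          |res α ξ x - m| ^ (-(1 : ℝ) / 2)) ≤
      ENNReal.ofReal (((α + 1) * 2 ^ α) ^ ((1 : ℝ) / 2)) *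
        ENNReal.ofReal (8 * (2 * (α + 1)) ^ ((1 : ℝ) / 2)) := by
  set T : Set ℝ := {x : ℝ | x ≠ 0 ∧ |x| ≤ |ξ| / 3 ∧ |res α ξ x| ≤ α * |m|} with hT
  have hres := continuous_res (by linarith : 1 < α) ξ
  have hTm : MeasurableSet T :=
    (measurableSet_singleton (0 : ℝ)).compl.inter
      ((measurableSet_le continuous_abs.measurable measurable_const).inter
        (measurableSet_le hres.abs.measurable measurable_const))
  have hinj := injOn_res hα hξ
  set K : ℝ := ((α + 1) * 2 ^ α) ^ ((1 : ℝ) / 2) with hK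
  set h : ℝ → ENNReal := fun s =>
    ENNReal.ofReal (|s| ^ (-(1 : ℝ) / 2) * |s - m| ^ (-(1 : ℝ) / 2)) with hh
  have hpt : ∀ x ∈ T, |x| ^ (-(1 : ℝ) / 2) * |ξ - x| ^ (α / 2) ≤
      K * (|(α + 1) * (|ξ - x| ^ α - |x| ^ α)| * |res α ξ x| ^ (-(1 : ℝ) / 2)) := by
    rintro x ⟨hx0, hx, -⟩
    have hX : 0 < |x| := abs_pos.2 hx0
    have hξ2 : 0 < |ξ - x| := by
      have := abs_sub_abs_le_abs_sub ξ x
      have := abs_pos.2 hξ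
      linarith
    have hY : 0 < |ξ - x| ^ α := Real.rpow_pos_of_pos hξ2 _
    have hR : 0 < |res α ξ x| := by
      refine abs_pos.2 fun h0 => hx0 (hinj hx ?_ (h0.trans (res_zero_right ξ).symm))
      show |(0 : ℝ)| ≤ |ξ| / 3
      rw [abs_zero]; positivity
    have hd := (abs_rpow_le_deriv_res hα hx).trans (le_abs_self _)
    have e : |ξ - x| ^ (α / 2) = (|ξ - x| ^ α) ^ ((1 : ℝ) / 2) := by
      rw [← Real.rpow_mul hξ2.le]; congr 1; ring
    have hle := Real.rpow_le_rpow hR.le (abs_res_le hα hx) (by norm_num : (0 : ℝ) ≤ 1 / 2)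
    rw [Real.mul_rpow (by positivity) (by positivity), ← hK,
      Real.mul_rpow (by positivity) (by positivity)] at hle
    rw [e]
    set X := |x|
    set Y := |ξ - x| ^ α
    set R := |res α ξ x|
    set D := |(α + 1) * (Y - X ^ α)|
    have neg : ∀ t : ℝ, 0 < t → t ^ (-(1 : ℝ) / 2) = (t ^ ((1 : ℝ) / 2))⁻¹ := fun t ht => by
      rw [← Real.rpow_neg ht.le]; norm_num
    have hYY : Y = Y ^ ((1 : ℝ) / 2) * Y ^ ((1 : ℝ) / 2) := by
      rw [← Real.rpow_add hY]; norm_num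
    rw [neg X hX, neg R hR, ← mul_assoc, ← div_eq_mul_inv, le_div_iff₀ (by positivity),
      mul_assoc, inv_mul_le_iff₀ (by positivity)]
    calc Y ^ ((1 : ℝ) / 2) * R ^ ((1 : ℝ) / 2)
        ≤ Y ^ ((1 : ℝ) / 2) * (K * (X ^ ((1 : ℝ) / 2) * Y ^ ((1 : ℝ) / 2))) := by gcongr
      _ = X ^ ((1 : ℝ) / 2) * (K * Y) := by
          nth_rewrite 3 [hYY]; ring
      _ ≤ _ := by gcongr
  calc _ ≤ ∫⁻ x in T, ENNReal.ofReal K *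
        (ENNReal.ofReal |(α + 1) * (|ξ - x| ^ α - |x| ^ α)| * h (res α ξ x)) := by
        refine setLIntegral_mono' hTm fun x hx => ?_
        rw [hh, ← ENNReal.ofReal_mul (abs_nonneg _), ← ENNReal.ofReal_mul (by positivity)]
        refine ENNReal.ofReal_le_ofReal ?_
        calc _ ≤ _ := mul_le_mul_of_nonneg_right (hpt x hx)
                (by positivity : 0 ≤ |res α ξ x - m| ^ (-(1 : ℝ) / 2))
          _ = _ := by ring
    _ = ENNReal.ofReal K * ∫⁻ s in res α ξ '' T, h s := by
        rw [lintegral_const_mul' _ _ ENNReal.ofReal_ne_top,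
          lintegral_image_eq_lintegral_abs_deriv_mul hTm
            (fun x _ => (hasDerivAt_res (by linarith) ξ x).hasDerivWithinAt)
            (hinj.mono fun x hx => hx.2.1)]
    _ ≤ ENNReal.ofReal K * ∫⁻ s in {s : ℝ | |s| ≤ α * |m|}, h s := by
        gcongr
        rintro _ ⟨x, hx, rfl⟩
        exact hx.2.2
    _ ≤ _ := by
        gcongr
        exact lintegral_two_singularities_le (by linarith) m

lemma lintegral_comp_parabola_half_le {A : ℝ} (hA : A ≠ 0) (c d : ℝ) (G : ℝ → ENNReal)
    {s : Set ℝ} (hs : s = Ioi d ∨ s = Iio d) :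
    2 * ∫⁻ x in s, G (c - (x - d) ^ 2 / A) ≤
      ENNReal.ofReal (|A| ^ ((1 : ℝ) / 2)) *
        ∫⁻ m, ENNReal.ofReal (|c - m| ^ (-(1 : ℝ) / 2)) * G m := by
  have hsm : MeasurableSet s := by
    rcases hs with rfl | rfl
    exacts [measurableSet_Ioi, measurableSet_Iio]
  have hsd : ∀ x ∈ s, x - d ≠ 0 := by
    rcases hs with rfl | rfl
    · exact fun x hx => (sub_pos.2 hx).ne'
    · exact fun x hx => (sub_neg.2 hx).ne
  have hA' : 0 < |A| := abs_pos.2 hA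
  have hder : ∀ x ∈ s, HasDerivWithinAt (fun x => c - (x - d) ^ 2 / A) (-(2 * (x - d) / A)) s x := by
    intro x _
    have h := ((((hasDerivAt_id x).sub_const d).pow 2).div_const A).const_sub c
    exact (h.congr_deriv (by simp)).hasDerivWithinAt
  have hinj : InjOn (fun x => c - (x - d) ^ 2 / A) s := by
    intro x hx y hy hxy
    have h1 : (x - d) ^ 2 = (y - d) ^ 2 := by
      have : (x - d) ^ 2 / A = (y - d) ^ 2 / A := by simpa using hxy
      field_simp at this
      exact this
    rcases sq_eq_sq_iff_eq_or_eq_neg.1 h1 with h | h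
    · linarith
    · rcases hs with rfl | rfl
      · have := sub_pos.2 (show d < x from hx); have := sub_pos.2 (show d < y from hy); linarith
      · have := sub_neg.2 (show x < d from hx); have := sub_neg.2 (show y < d from hy); linarith
  have key := lintegral_image_eq_lintegral_abs_deriv_mul hsm hder hinj
    (fun m => ENNReal.ofReal (|c - m| ^ (-(1 : ℝ) / 2)) * G m)
  have hpt : ∀ x ∈ s, 2 * G (c - (x - d) ^ 2 / A) = ENNReal.ofReal (|A| ^ ((1 : ℝ) / 2)) *
      (ENNReal.ofReal |-(2 * (x - d) / A)| *
        (ENNReal.ofReal (|c - (c - (x - d) ^ 2 / A)| ^ (-(1 : ℝ) / 2)) *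
          G (c - (x - d) ^ 2 / A))) := by
    intro x hx
    have hx' : 0 < |x - d| := abs_pos.2 (hsd x hx)
    rw [← mul_assoc, ← mul_assoc, ← ENNReal.ofReal_mul (by positivity),
      ← ENNReal.ofReal_mul (by positivity)]
    congr 1
    have e1 : |c - (c - (x - d) ^ 2 / A)| = |x - d| ^ (2 : ℝ) / |A| := by
      rw [sub_sub_cancel, abs_div, abs_pow]; norm_num
    have e2 : |-(2 * (x - d) / A)| = 2 * |x - d| / |A| := by
      rw [abs_neg, abs_div, abs_mul]; norm_num
    have e3 : (|x - d| ^ (2 : ℝ) / |A|) ^ (-(1 : ℝ) / 2) = |A| ^ ((1 : ℝ) / 2) / |x - d| := by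
      rw [Real.div_rpow (by positivity) hA'.le, ← Real.rpow_mul hx'.le, neg_div,
        Real.rpow_neg hA'.le]
      norm_num [Real.rpow_neg_one]
      field_simp
    have e4 : |A| ^ ((1 : ℝ) / 2) * |A| ^ ((1 : ℝ) / 2) = |A| := by
      rw [← Real.rpow_add hA']; norm_num
    rw [e1, e2, e3]
    have : |A| ^ ((1 : ℝ) / 2) * (2 * |x - d| / |A|) * (|A| ^ ((1 : ℝ) / 2) / |x - d|) = 2 := by
      field_simp
      linear_combination e4
    rw [this]; norm_num
  calc _ = ∫⁻ x in s, 2 * G (c - (x - d) ^ 2 / A) :=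
        (lintegral_const_mul' _ _ (by norm_num)).symm
    _ = _ := setLIntegral_congr_fun hsm hpt
    _ = _ := lintegral_const_mul' _ _ ENNReal.ofReal_ne_top
    _ ≤ _ := by
        rw [← key]
        exact mul_le_mul_right (setLIntegral_le_lintegral _ _) _

/-- Substitution bound for a function composed with a parabola. -/
lemma lintegral_comp_parabola_le {A : ℝ} (hA : A ≠ 0) (c d : ℝ) (G : ℝ → ENNReal) :
    ∫⁻ x, G (c - (x - d) ^ 2 / A) ≤
      ENNReal.ofReal (|A| ^ ((1 : ℝ) / 2)) *
        ∫⁻ m, ENNReal.ofReal (|c - m| ^ (-(1 : ℝ) / 2)) * G m := by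
  have h1 := lintegral_comp_parabola_half_le hA c d G (Or.inl rfl)
  have h2 := lintegral_comp_parabola_half_le hA c d G (Or.inr rfl)
  set I := ENNReal.ofReal (|A| ^ ((1 : ℝ) / 2)) *
        ∫⁻ m, ENNReal.ofReal (|c - m| ^ (-(1 : ℝ) / 2)) * G m
  have h3 : ∫⁻ x, G (c - (x - d) ^ 2 / A) =
      (∫⁻ x in Iio d, G (c - (x - d) ^ 2 / A)) + ∫⁻ x in Ioi d, G (c - (x - d) ^ 2 / A) := by
    rw [← lintegral_add_compl _ (measurableSet_Iio (a := d)), compl_Iio,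
      ← restrict_Ioi_eq_restrict_Ici]
  have h4 : 2 * ∫⁻ x, G (c - (x - d) ^ 2 / A) ≤ 2 * I := by
    rw [h3, mul_add, two_mul I]
    exact add_le_add h2 h1
  exact (ENNReal.mul_le_mul_iff_right (by norm_num) (by norm_num)).1 h4

lemma sigma_sub_sigma_sub_sigma {α ξ μ τ x y t : ℝ} (hξ : ξ ≠ 0) (hx : x ≠ 0)
    (hxξ : ξ - x ≠ 0) :
    sigma α (ξ, μ, τ) - sigma α (x, y, t) - sigma α (sub3 (ξ, μ, τ) (x, y, t)) =
      res α ξ x - (y - μ * x / ξ) ^ 2 / (x * (ξ - x) / ξ) := by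
  simp only [sigma, phi, sub3, res]
  field_simp
  ring

/-- The squared weight `⟨x⟩^{-2b}`, valued in `ENNReal`. -/
noncomputable def bracketWeight (b x : ℝ) : ENNReal := ENNReal.ofReal ((1 + |x|) ^ (-(2 * b)))

lemma measurable_bracketWeight (b : ℝ) : Measurable (bracketWeight b) := by
  unfold bracketWeight; fun_prop

lemma lintegral_bracketWeight_lt_top {b : ℝ} (hb : 1 / 2 < b) :
    ∫⁻ x, bracketWeight b x < ⊤ := by
  have h := integrable_one_add_norm (E := ℝ) (μ := volume) (r := 2 * b) (by
    rw [Module.finrank_self]; norm_num; linarith)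
  have h2 := h.2
  rw [hasFiniteIntegral_iff_ofReal (Filter.Eventually.of_forall fun x => by positivity)] at h2
  exact h2

lemma bracketWeight_mul_le {b : ℝ} (hb : 0 ≤ b) (x y : ℝ) :
    bracketWeight b x * bracketWeight b y ≤
      ENNReal.ofReal (2 ^ (2 * b)) * bracketWeight b (x + y) *
        (bracketWeight b x + bracketWeight b y) := by
  have key : ∀ u v : ℝ, |v| ≤ |u| →
      bracketWeight b u ≤ ENNReal.ofReal (2 ^ (2 * b)) * bracketWeight b (u + v) := by
    intro u v huv
    unfold bracketWeight
    rw [← ENNReal.ofReal_mul (by positivity)]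
    refine ENNReal.ofReal_le_ofReal ?_
    have h1 : (1 + |u + v|) / 2 ≤ 1 + |u| := by
      have := abs_add_le u v
      have := abs_nonneg u
      linarith
    have h2 := Real.rpow_le_rpow_of_nonpos (by positivity) h1 (by linarith : -(2 * b) ≤ 0)
    rw [Real.div_rpow (by positivity) (by norm_num), Real.rpow_neg (by norm_num : (0 : ℝ) ≤ 2),
      div_inv_eq_mul] at h2
    linarith
  rcases le_total |y| |x| with h | h
  · calc _ ≤ ENNReal.ofReal (2 ^ (2 * b)) * bracketWeight b (x + y) * bracketWeight b y := by
          gcongr; exact key x y h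
      _ ≤ _ := by gcongr; exact le_add_self
  · calc _ ≤ bracketWeight b x * (ENNReal.ofReal (2 ^ (2 * b)) * bracketWeight b (x + y)) := by
          gcongr; rw [add_comm]; exact key y x h
      _ = ENNReal.ofReal (2 ^ (2 * b)) * bracketWeight b (x + y) * bracketWeight b x := by ring
      _ ≤ _ := by gcongr; exact le_self_add

/-- The region of integration: low-high interaction under the resonance hypothesis. -/
def resonantRegion (α : ℝ) : Set ((ℝ × ℝ × ℝ) × (ℝ × ℝ × ℝ)) :=
  {q : (ℝ × ℝ × ℝ) × (ℝ × ℝ × ℝ) |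
    q.1.1 ≠ 0 ∧ q.2.1 ≠ 0 ∧ q.2.1 - q.1.1 ≠ 0 ∧
    |q.1.1| ≤ |q.2.1 - q.1.1| / 4 ∧
    |res α q.2.1 q.1.1| / α ≤
      |sigma α q.2 - sigma α q.1 - sigma α (sub3 q.2 q.1)|}

/-- The multiplier of the trilinear form. -/
noncomputable def multiplier (α b : ℝ) (q : (ℝ × ℝ × ℝ) × (ℝ × ℝ × ℝ)) : ℝ :=
  |q.1.1| ^ (-(1 : ℝ) / 2) * |q.2.1 - q.1.1| ^ (α / 4) *
    (1 + |sigma α q.1|) ^ (-b) * (1 + |sigma α (sub3 q.2 q.1)|) ^ (-b)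

lemma measurable_sigma (α : ℝ) : Measurable (sigma α) := by
  unfold sigma phi; fun_prop

lemma measurable_sub3 :
    Measurable fun q : (ℝ × ℝ × ℝ) × (ℝ × ℝ × ℝ) => sub3 q.2 q.1 := by
  unfold sub3; fun_prop

lemma measurableSet_resonantRegion (α : ℝ) : MeasurableSet (resonantRegion α) := by
  have h1 := measurable_sigma α
  have h2 := h1.comp measurable_sub3
  simp only [Function.comp_def] at h2
  have h3 : Measurable fun q : (ℝ × ℝ × ℝ) × (ℝ × ℝ × ℝ) => res α q.2.1 q.1.1 := by
    unfold res; fun_prop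
  have ne : ∀ g : (ℝ × ℝ × ℝ) × (ℝ × ℝ × ℝ) → ℝ, Measurable g → MeasurableSet {q | g q ≠ 0} :=
    fun g hg => (measurableSet_eq_fun hg measurable_const).compl
  unfold resonantRegion
  refine (ne _ (by fun_prop)).inter ((ne _ (by fun_prop)).inter ((ne _ (by fun_prop)).inter
    ((measurableSet_le (f := fun q : (ℝ × ℝ × ℝ) × (ℝ × ℝ × ℝ) => |q.1.1|)
      (g := fun q => |q.2.1 - q.1.1| / 4)
      (by fun_prop) (by fun_prop)).inter (measurableSet_le
        (f := fun q : (ℝ × ℝ × ℝ) × (ℝ × ℝ × ℝ) => |res α q.2.1 q.1.1| / α)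
        (g := fun q => |sigma α q.2 - sigma α q.1 - sigma α (sub3 q.2 q.1)|) ?_ ?_))))
  · exact (continuous_abs.measurable.comp h3).div_const α
  · exact continuous_abs.measurable.comp (((h1.comp measurable_snd).sub
      (h1.comp measurable_fst)).sub h2)

lemma measurable_multiplier (α b : ℝ) : Measurable (multiplier α b) := by
  have h1 := measurable_sigma α
  have h2 := h1.comp measurable_sub3
  simp only [Function.comp_def] at h2
  unfold multiplier
  fun_prop

/-- The slices `{(x, m) : x ≠ 0, |x| ≤ |ξ|/3, |res α ξ x| ≤ α |m|}` carrying the resonant region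
after `m = σ - σ₁ - σ₂` is taken as a variable. -/
def resonantSlice (α ξ : ℝ) : Set (ℝ × ℝ) :=
  {z | z.1 ≠ 0 ∧ |z.1| ≤ |ξ| / 3 ∧ |res α ξ z.1| ≤ α * |z.2|}

lemma measurableSet_resonantSlice {α : ℝ} (hα : 4 ≤ α) (ξ : ℝ) :
    MeasurableSet (resonantSlice α ξ) := by
  have h := (continuous_res (by linarith : 1 < α) ξ).measurable
  exact (measurableSet_eq_fun measurable_fst measurable_const).compl.inter
    ((measurableSet_le (f := fun z : ℝ × ℝ => |z.1|) (g := fun _ => |ξ| / 3)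
      (by fun_prop) (by fun_prop)).inter
      (measurableSet_le (f := fun z : ℝ × ℝ => |res α ξ z.1|) (g := fun z => α * |z.2|)
        (by fun_prop) (by fun_prop)))

lemma multiplier_sq_le {α b ξ μ τ x y t : ℝ} (hα : 4 ≤ α) (hb : 0 ≤ b) :
    (resonantRegion α).indicator (fun q => ENNReal.ofReal (multiplier α b q))
        ((x, y, t), (ξ, μ, τ)) ^ (2 : ℝ) ≤
      ENNReal.ofReal (2 ^ (2 * b)) * ENNReal.ofReal (|x| ^ (-1 : ℝ) * |ξ - x| ^ (α / 2)) *
        (resonantSlice α ξ).indicator (fun z => bracketWeight b (sigma α (ξ, μ, τ) - z.2))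
          (x, res α ξ x - (y - μ * x / ξ) ^ 2 / (x * (ξ - x) / ξ)) *
        (bracketWeight b (t + phi α x y) + bracketWeight b (τ - t + phi α (ξ - x) (μ - y))) := by
  by_cases hq : ((x, y, t), (ξ, μ, τ)) ∈ resonantRegion α
  swap
  · rw [indicator_of_notMem hq, ENNReal.zero_rpow_of_pos (by norm_num)]
    exact zero_le
  rw [indicator_of_mem hq]
  obtain ⟨hx, hξ, hxξ, hle, hres⟩ := hq
  simp only at hx hξ hxξ hle hres
  have hM := sigma_sub_sigma_sub_sigma (α := α) (μ := μ) (τ := τ) (y := y) (t := t) hξ hx hxξ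
  rw [hM, div_le_iff₀ (by linarith), mul_comm _ α] at hres
  have hx3 : |x| ≤ |ξ| / 3 := by
    have := abs_sub ξ x
    linarith
  rw [indicator_of_mem (show (x, _) ∈ resonantSlice α ξ from ⟨hx, hx3, hres⟩)]
  simp only
  have hs : sigma α (ξ, μ, τ) - (res α ξ x - (y - μ * x / ξ) ^ 2 / (x * (ξ - x) / ξ)) =
      (t + phi α x y) + (τ - t + phi α (ξ - x) (μ - y)) := by
    rw [← hM]; simp only [sigma, sub3]; ring
  rw [hs]
  set u := t + phi α x y with hu
  set v := τ - t + phi α (ξ - x) (μ - y) with hv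
  have hsq : ENNReal.ofReal (multiplier α b ((x, y, t), (ξ, μ, τ))) ^ (2 : ℝ) =
      ENNReal.ofReal (|x| ^ (-1 : ℝ) * |ξ - x| ^ (α / 2)) *
        (bracketWeight b u * bracketWeight b v) := by
    unfold bracketWeight
    rw [ENNReal.ofReal_rpow_of_nonneg (by unfold multiplier; positivity) (by norm_num),
      ← ENNReal.ofReal_mul (by positivity), ← ENNReal.ofReal_mul (by positivity)]
    congr 1
    have e1 : sigma α (x, y, t) = u := rfl
    have e2 : sigma α (sub3 (ξ, μ, τ) (x, y, t)) = v := rfl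
    simp only [multiplier]
    rw [e1, e2, Real.mul_rpow (by positivity) (by positivity),
      Real.mul_rpow (by positivity) (by positivity), Real.mul_rpow (by positivity) (by positivity),
      ← Real.rpow_mul (by positivity), ← Real.rpow_mul (by positivity),
      ← Real.rpow_mul (by positivity), ← Real.rpow_mul (by positivity), mul_assoc]
    ring_nf
  rw [hsq]
  calc _ ≤ ENNReal.ofReal (|x| ^ (-1 : ℝ) * |ξ - x| ^ (α / 2)) *
        (ENNReal.ofReal (2 ^ (2 * b)) * bracketWeight b (u + v) *
          (bracketWeight b u + bracketWeight b v)) :=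
        mul_le_mul_right (bracketWeight_mul_le hb u v) _
    _ = _ := by ring

/-- The integral in `y = μ₁`, with `m = σ - σ₁ - σ₂` as new variable. -/
lemma lintegral_slice_le {α ξ : ℝ} (hξ : ξ ≠ 0) (d x : ℝ) (g : ℝ → ENNReal) :
    ENNReal.ofReal (|x| ^ (-1 : ℝ) * |ξ - x| ^ (α / 2)) *
      ∫⁻ y, (resonantSlice α ξ).indicator (fun z => g z.2)
        (x, res α ξ x - (y - d) ^ 2 / (x * (ξ - x) / ξ)) ≤
    2 * ∫⁻ m, (resonantSlice α ξ).indicator (fun z =>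
      ENNReal.ofReal (|z.1| ^ (-(1 : ℝ) / 2) * |ξ - z.1| ^ (α / 2) *
        |res α ξ z.1 - z.2| ^ (-(1 : ℝ) / 2)) * g z.2) (x, m) := by
  by_cases hx : x ≠ 0 ∧ |x| ≤ |ξ| / 3
  swap
  · have : ∀ m, (x, m) ∉ resonantSlice α ξ := fun m hm => hx ⟨hm.1, hm.2.1⟩
    simp [indicator_of_notMem (this _)]
  obtain ⟨hx0, hx3⟩ := hx
  have hX : 0 < |x| := abs_pos.2 hx0
  have hξ' : 0 < |ξ| := abs_pos.2 hξ
  have hlow : |ξ| * (2 / 3) ≤ |ξ - x| := by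
    have := abs_sub_abs_le_abs_sub ξ x
    linarith
  have hhigh : |ξ - x| ≤ |ξ| * (4 / 3) := by
    have := abs_sub ξ x
    linarith
  have hxξ : ξ - x ≠ 0 := abs_pos.1 (by linarith)
  set A := x * (ξ - x) / ξ with hA
  have hA0 : A ≠ 0 := div_ne_zero (mul_ne_zero hx0 hxξ) hξ
  have hAle : |A| ≤ 4 * |x| := by
    rw [hA, abs_div, abs_mul, div_le_iff₀ hξ']
    nlinarith
  have hAhalf : |A| ^ ((1 : ℝ) / 2) ≤ 2 * |x| ^ ((1 : ℝ) / 2) := by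
    calc |A| ^ ((1 : ℝ) / 2) ≤ (4 * |x|) ^ ((1 : ℝ) / 2) := by gcongr
      _ = 2 * |x| ^ ((1 : ℝ) / 2) := by
        rw [Real.mul_rpow (by norm_num) (by positivity), ← Real.sqrt_eq_rpow,
          show (4 : ℝ) = 2 ^ 2 by norm_num, Real.sqrt_sq (by norm_num)]
  have hpow : |x| ^ (-1 : ℝ) * |x| ^ ((1 : ℝ) / 2) = |x| ^ (-(1 : ℝ) / 2) := by
    rw [← Real.rpow_add hX]; norm_num
  have hcoef : |x| ^ (-1 : ℝ) * |ξ - x| ^ (α / 2) * |A| ^ ((1 : ℝ) / 2) ≤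
      2 * (|x| ^ (-(1 : ℝ) / 2) * |ξ - x| ^ (α / 2)) := by
    calc _ ≤ |x| ^ (-1 : ℝ) * |ξ - x| ^ (α / 2) * (2 * |x| ^ ((1 : ℝ) / 2)) := by gcongr
      _ = _ := by rw [← hpow]; ring
  calc _ ≤ ENNReal.ofReal (|x| ^ (-1 : ℝ) * |ξ - x| ^ (α / 2)) *
        (ENNReal.ofReal (|A| ^ ((1 : ℝ) / 2)) *
          ∫⁻ m, ENNReal.ofReal (|res α ξ x - m| ^ (-(1 : ℝ) / 2)) *
            (resonantSlice α ξ).indicator (fun z => g z.2) (x, m)) := by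
        gcongr
        exact lintegral_comp_parabola_le hA0 (res α ξ x) d
          (fun m => (resonantSlice α ξ).indicator (fun z => g z.2) (x, m))
    _ ≤ ENNReal.ofReal (2 * (|x| ^ (-(1 : ℝ) / 2) * |ξ - x| ^ (α / 2))) *
          ∫⁻ m, ENNReal.ofReal (|res α ξ x - m| ^ (-(1 : ℝ) / 2)) *
            (resonantSlice α ξ).indicator (fun z => g z.2) (x, m) := by
        rw [← mul_assoc, ← ENNReal.ofReal_mul (by positivity)]
        gcongr
    _ = _ := by
        rw [ENNReal.ofReal_mul (by norm_num), mul_assoc,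
          ← lintegral_const_mul' _ _ ENNReal.ofReal_ne_top]
        congr 1
        · norm_num
        refine lintegral_congr fun m => ?_
        by_cases hm : (x, m) ∈ resonantSlice α ξ
        · rw [indicator_of_mem hm, indicator_of_mem hm, ← mul_assoc,
            ← ENNReal.ofReal_mul (by positivity)]
        · rw [indicator_of_notMem hm, indicator_of_notMem hm, mul_zero, mul_zero]

/-- The double integral in `(ξ₁, m)`. -/
lemma lintegral_lintegral_slice_le {α ξ : ℝ} (hα : 4 ≤ α) (hξ : ξ ≠ 0) {g : ℝ → ENNReal}
    (hg : Measurable g) :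
    ∫⁻ x, ∫⁻ m, (resonantSlice α ξ).indicator (fun z =>
      ENNReal.ofReal (|z.1| ^ (-(1 : ℝ) / 2) * |ξ - z.1| ^ (α / 2) *
        |res α ξ z.1 - z.2| ^ (-(1 : ℝ) / 2)) * g z.2) (x, m) ≤
    ENNReal.ofReal (((α + 1) * 2 ^ α) ^ ((1 : ℝ) / 2)) *
      ENNReal.ofReal (8 * (2 * (α + 1)) ^ ((1 : ℝ) / 2)) * ∫⁻ m, g m := by
  have hres := (continuous_res (by linarith : 1 < α) ξ).measurable
  have hS := measurableSet_resonantSlice hα ξ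
  have hmeas : Measurable ((resonantSlice α ξ).indicator (fun z =>
      ENNReal.ofReal (|z.1| ^ (-(1 : ℝ) / 2) * |ξ - z.1| ^ (α / 2) *
        |res α ξ z.1 - z.2| ^ (-(1 : ℝ) / 2)) * g z.2)) :=
    Measurable.indicator (by fun_prop) hS
  rw [lintegral_lintegral_swap (f := fun x m => (resonantSlice α ξ).indicator (fun z =>
      ENNReal.ofReal (|z.1| ^ (-(1 : ℝ) / 2) * |ξ - z.1| ^ (α / 2) *
        |res α ξ z.1 - z.2| ^ (-(1 : ℝ) / 2)) * g z.2) (x, m)) hmeas.aemeasurable,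
    ← lintegral_const_mul _ hg]
  refine lintegral_mono fun m => ?_
  have hT : MeasurableSet {x : ℝ | (x, m) ∈ resonantSlice α ξ} :=
    hS.preimage (measurable_id.prodMk measurable_const)
  have : ∀ x, (resonantSlice α ξ).indicator (fun z =>
      ENNReal.ofReal (|z.1| ^ (-(1 : ℝ) / 2) * |ξ - z.1| ^ (α / 2) *
        |res α ξ z.1 - z.2| ^ (-(1 : ℝ) / 2)) * g z.2) (x, m) =
      {x : ℝ | (x, m) ∈ resonantSlice α ξ}.indicator (fun x =>
        ENNReal.ofReal (|x| ^ (-(1 : ℝ) / 2) * |ξ - x| ^ (α / 2) *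
        |res α ξ x - m| ^ (-(1 : ℝ) / 2))) x * g m := by
    intro x
    by_cases hm : (x, m) ∈ resonantSlice α ξ
    · rw [indicator_of_mem hm, indicator_of_mem (show x ∈ {x : ℝ | (x, m) ∈ resonantSlice α ξ} from hm)]
    · rw [indicator_of_notMem hm, indicator_of_notMem (show x ∉ {x : ℝ | (x, m) ∈ resonantSlice α ξ} from hm), zero_mul]
  simp_rw [this]
  rw [lintegral_mul_const _ (Measurable.indicator (by fun_prop) hT), lintegral_indicator hT]
  gcongr
  exact lintegral_res_le hα hξ m

/-- The squared multiplier has uniformly bounded integral in the first frequency variable. -/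
lemma exists_lintegral_multiplier_sq_le {α b : ℝ} (hα : 4 ≤ α) (hb : 1 / 2 < b) :
    ∃ C : ENNReal, C ≠ ⊤ ∧ ∀ p : ℝ × ℝ × ℝ,
      ∫⁻ p₁, (resonantRegion α).indicator (fun q => ENNReal.ofReal (multiplier α b q)) (p₁, p) ^
        (2 : ℝ) ≤ C := by
  set W : ENNReal := ∫⁻ x, bracketWeight b x with hW
  have hWtop : W ≠ ⊤ := (lintegral_bracketWeight_lt_top hb).ne
  set c : ENNReal := ENNReal.ofReal (2 ^ (2 * b)) with hc
  set B : ENNReal := ENNReal.ofReal (((α + 1) * 2 ^ α) ^ ((1 : ℝ) / 2)) *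
      ENNReal.ofReal (8 * (2 * (α + 1)) ^ ((1 : ℝ) / 2)) with hB
  have hw := measurable_bracketWeight b
  refine ⟨c * (2 * W) * (2 * (B * W)), by finiteness, ?_⟩
  rintro ⟨ξ, μ, τ⟩
  rcases eq_or_ne ξ 0 with rfl | hξ
  · have : ∀ p₁ : ℝ × ℝ × ℝ, (p₁, ((0 : ℝ), μ, τ)) ∉ resonantRegion α := fun p₁ h => h.2.1 rfl
    simp [indicator_of_notMem (this _)]
  set s := sigma α (ξ, μ, τ) with hs
  set k : ℝ → ENNReal := fun x => ENNReal.ofReal (|x| ^ (-1 : ℝ) * |ξ - x| ^ (α / 2)) with hk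
  set H : ℝ → ℝ → ENNReal := fun x y =>
    (resonantSlice α ξ).indicator (fun z => bracketWeight b (s - z.2))
      (x, res α ξ x - (y - μ * x / ξ) ^ 2 / (x * (ξ - x) / ξ)) with hH
  have hinner : ∀ x y, ∫⁻ t, (bracketWeight b (t + phi α x y) +
      bracketWeight b (τ - t + phi α (ξ - x) (μ - y))) = 2 * W := by
    intro x y
    rw [lintegral_add_left (by fun_prop), lintegral_add_right_eq_self, two_mul,
      lintegral_sub_left_eq_self (fun t => bracketWeight b (t + phi α (ξ - x) (μ - y))),
      lintegral_add_right_eq_self]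
  calc _ ≤ ∫⁻ x, ∫⁻ y, ∫⁻ t, (resonantRegion α).indicator
          (fun q => ENNReal.ofReal (multiplier α b q)) ((x, y, t), (ξ, μ, τ)) ^ (2 : ℝ) :=
        (lintegral_prod_le _).trans (lintegral_mono fun x => lintegral_prod_le _)
    _ ≤ ∫⁻ x, ∫⁻ y, ∫⁻ t, c * k x * H x y * (bracketWeight b (t + phi α x y) +
          bracketWeight b (τ - t + phi α (ξ - x) (μ - y))) :=
        lintegral_mono fun x => lintegral_mono fun y => lintegral_mono fun t =>
          multiplier_sq_le hα (by linarith)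
    _ = ∫⁻ x, c * (2 * W) * (k x * ∫⁻ y, H x y) := by
        refine lintegral_congr fun x => ?_
        have : ∀ y, ∫⁻ t, c * k x * H x y * (bracketWeight b (t + phi α x y) +
            bracketWeight b (τ - t + phi α (ξ - x) (μ - y))) =
            c * (2 * W) * k x * H x y := by
          intro y
          rw [lintegral_const_mul _ (by fun_prop), hinner]
          ring
        simp_rw [this]
        rw [lintegral_const_mul' _ _ (by finiteness), mul_assoc]
    _ = c * (2 * W) * ∫⁻ x, k x * ∫⁻ y, H x y :=
        lintegral_const_mul' _ _ (by finiteness)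
    _ ≤ c * (2 * W) * ∫⁻ x, 2 * ∫⁻ m, (resonantSlice α ξ).indicator (fun z =>
          ENNReal.ofReal (|z.1| ^ (-(1 : ℝ) / 2) * |ξ - z.1| ^ (α / 2) *
            |res α ξ z.1 - z.2| ^ (-(1 : ℝ) / 2)) * bracketWeight b (s - z.2)) (x, m) :=
        mul_le_mul_right (lintegral_mono fun x =>
          lintegral_slice_le hξ (μ * x / ξ) x (fun m => bracketWeight b (s - m))) _
    _ ≤ _ := by
        rw [lintegral_const_mul' _ _ (by norm_num)]
        gcongr
        refine (lintegral_lintegral_slice_le hα hξ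
          (g := fun m => bracketWeight b (s - m)) (by fun_prop)).trans_eq ?_
        rw [lintegral_sub_left_eq_self (bracketWeight b) s]

lemma eLpNorm_two_eq {f : ℝ × ℝ × ℝ → ℝ} (hf : ∀ p, 0 ≤ f p) :
    eLpNorm f 2 volume = (∫⁻ p, ENNReal.ofReal (f p) ^ (2 : ℝ)) ^ (1 / (2 : ℝ)) := by
  rw [eLpNorm_eq_lintegral_rpow_enorm_toReal (by norm_num) (by norm_num)]
  simp [Real.enorm_of_nonneg (hf _)]

/-- Bounded trilinear form from a Schur-type bound on the kernel. -/
lemma lintegral_trilinear_le {K : (ℝ × ℝ × ℝ) × (ℝ × ℝ × ℝ) → ENNReal} (hK : Measurable K)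
    {C : ENNReal} (hC : ∀ p, ∫⁻ p₁, K (p₁, p) ^ (2 : ℝ) ≤ C)
    {F F₁ F₂ : ℝ × ℝ × ℝ → ENNReal} (hF : Measurable F) (hF₁ : Measurable F₁)
    (hF₂ : Measurable F₂) :
    ∫⁻ q : (ℝ × ℝ × ℝ) × (ℝ × ℝ × ℝ), (K q * F q.2) * (F₁ q.1 * F₂ (sub3 q.2 q.1)) ≤
      C ^ (1 / (2 : ℝ)) * (∫⁻ p, F p ^ (2 : ℝ)) ^ (1 / (2 : ℝ)) *
        (∫⁻ p, F₁ p ^ (2 : ℝ)) ^ (1 / (2 : ℝ)) * (∫⁻ p, F₂ p ^ (2 : ℝ)) ^ (1 / (2 : ℝ)) := by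
  have hF₂' : Measurable fun q : (ℝ × ℝ × ℝ) × (ℝ × ℝ × ℝ) => F₂ (sub3 q.2 q.1) :=
    hF₂.comp measurable_sub3
  have holder := ENNReal.lintegral_mul_le_Lp_mul_Lq
    (volume : Measure ((ℝ × ℝ × ℝ) × (ℝ × ℝ × ℝ))) Real.HolderConjugate.two_two
    (f := fun q => K q * F q.2) (g := fun q => F₁ q.1 * F₂ (sub3 q.2 q.1))
    (by fun_prop) ((hF₁.comp measurable_fst).mul hF₂').aemeasurable
  have h1 : ∫⁻ q : (ℝ × ℝ × ℝ) × (ℝ × ℝ × ℝ), (K q * F q.2) ^ (2 : ℝ) ≤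
      C * ∫⁻ p, F p ^ (2 : ℝ) := by
    have hm : Measurable fun q : (ℝ × ℝ × ℝ) × (ℝ × ℝ × ℝ) => (K q * F q.2) ^ (2 : ℝ) := by
      fun_prop
    refine (lintegral_prod_symm _ hm.aemeasurable).trans_le ?_
    rw [← lintegral_const_mul _ (by fun_prop)]
    refine lintegral_mono fun p => ?_
    simp_rw [ENNReal.mul_rpow_of_nonneg _ _ (by norm_num : (0 : ℝ) ≤ 2)]
    rw [lintegral_mul_const _ (by fun_prop)]
    gcongr
    exact hC p
  have h2 : ∫⁻ q : (ℝ × ℝ × ℝ) × (ℝ × ℝ × ℝ), (F₁ q.1 * F₂ (sub3 q.2 q.1)) ^ (2 : ℝ) ≤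
      (∫⁻ p, F₁ p ^ (2 : ℝ)) * ∫⁻ p, F₂ p ^ (2 : ℝ) := by
    refine (lintegral_prod_le _).trans ?_
    rw [← lintegral_mul_const _ (by fun_prop)]
    refine lintegral_mono fun p₁ => ?_
    simp_rw [ENNReal.mul_rpow_of_nonneg _ _ (by norm_num : (0 : ℝ) ≤ 2)]
    have hm : Measurable fun p => F₂ (sub3 p p₁) ^ (2 : ℝ) :=
      (hF₂'.comp (measurable_const.prodMk measurable_id)).pow_const 2
    rw [lintegral_const_mul _ hm]
    have : (volume : Measure (ℝ × ℝ × ℝ)).IsAddRightInvariant :=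
      have : (volume : Measure (ℝ × ℝ)).IsAddLeftInvariant :=
        inferInstanceAs ((volume : Measure ℝ).prod (volume : Measure ℝ)).IsAddLeftInvariant
      have : (volume : Measure (ℝ × ℝ × ℝ)).IsAddLeftInvariant :=
        inferInstanceAs ((volume : Measure ℝ).prod (volume : Measure (ℝ × ℝ))).IsAddLeftInvariant
      inferInstance
    exact (congrArg (F₁ p₁ ^ (2 : ℝ) * ·)
      (lintegral_sub_right_eq_self (fun p => F₂ p ^ (2 : ℝ)) p₁)).le
  calc _ ≤ _ := holder
    _ ≤ (C * ∫⁻ p, F p ^ (2 : ℝ)) ^ (1 / (2 : ℝ)) *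
        ((∫⁻ p, F₁ p ^ (2 : ℝ)) * ∫⁻ p, F₂ p ^ (2 : ℝ)) ^ (1 / (2 : ℝ)) := by gcongr
    _ = _ := by
        rw [ENNReal.mul_rpow_of_nonneg _ _ (by norm_num), ENNReal.mul_rpow_of_nonneg _ _ (by norm_num)]
        ring

/-- **Paper's Lemma 2.4 in its equivalent dual integral form (2.010).**
For `α ≥ 4` and `b > 1/2` there is `C > 0` such that for all nonnegative
`f, f₁, f₂ ∈ L²(ℝ³)`, the integral over the region
`{ξ₁ ≠ 0, ξ ≠ 0, ξ₂ := ξ − ξ₁ ≠ 0, |ξ₁| ≤ |ξ₂|/4, |σ − σ₁ − σ₂| ≥ |Δ|/α}` of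
`|ξ₁|^{-1/2} |ξ₂|^{α/4} ⟨σ₁⟩^{-b} ⟨σ₂⟩^{-b} f(ξ,μ,τ) f₁(ξ₁,μ₁,τ₁) f₂(ξ₂,μ₂,τ₂)`
is at most `C ‖f‖_{L²} ‖f₁‖_{L²} ‖f₂‖_{L²}`, where `(μ₂, τ₂) = (μ − μ₁, τ − τ₁)`. -/
theorem stmt8 (α b : ℝ) (hα : 4 ≤ α) (hb : 1 / 2 < b) :
    ∃ C : ℝ, 0 < C ∧ ∀ f f₁ f₂ : ℝ × ℝ × ℝ → ℝ,
      Measurable f → Measurable f₁ → Measurable f₂ →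
      (∀ p, 0 ≤ f p) → (∀ p, 0 ≤ f₁ p) → (∀ p, 0 ≤ f₂ p) →
      (∫⁻ q : (ℝ × ℝ × ℝ) × (ℝ × ℝ × ℝ) in
          {q : (ℝ × ℝ × ℝ) × (ℝ × ℝ × ℝ) |
            q.1.1 ≠ 0 ∧ q.2.1 ≠ 0 ∧ q.2.1 - q.1.1 ≠ 0 ∧
            |q.1.1| ≤ |q.2.1 - q.1.1| / 4 ∧
            |res α q.2.1 q.1.1| / α ≤
              |sigma α q.2 - sigma α q.1 - sigma α (sub3 q.2 q.1)|},
          ENNReal.ofReal (|q.1.1| ^ (-(1 : ℝ) / 2) * |q.2.1 - q.1.1| ^ (α / 4) *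
            (1 + |sigma α q.1|) ^ (-b) * (1 + |sigma α (sub3 q.2 q.1)|) ^ (-b) *
            (f q.2 * f₁ q.1 * f₂ (sub3 q.2 q.1)))) ≤
        ENNReal.ofReal C * eLpNorm f 2 volume * eLpNorm f₁ 2 volume *
          eLpNorm f₂ 2 volume := by
  obtain ⟨C, hCtop, hC⟩ := exists_lintegral_multiplier_sq_le hα hb
  refine ⟨(C ^ (1 / (2 : ℝ))).toReal + 1, by positivity, ?_⟩
  intro f f₁ f₂ hf hf₁ hf₂ hf0 hf₁0 hf₂0
  have hR := measurableSet_resonantRegion α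
  have hK : Measurable ((resonantRegion α).indicator
      fun q => ENNReal.ofReal (multiplier α b q)) :=
    (measurable_multiplier α b).ennreal_ofReal.indicator hR
  have hCle : C ^ (1 / (2 : ℝ)) ≤ ENNReal.ofReal ((C ^ (1 / (2 : ℝ))).toReal + 1) := by
    have : C ^ (1 / (2 : ℝ)) ≠ ⊤ := by finiteness
    rw [← ENNReal.ofReal_toReal this]
    exact ENNReal.ofReal_le_ofReal (by rw [ENNReal.toReal_ofReal ENNReal.toReal_nonneg]; linarith)
  rw [eLpNorm_two_eq hf0, eLpNorm_two_eq hf₁0, eLpNorm_two_eq hf₂0]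
  refine le_trans (le_of_eq ?_) ((lintegral_trilinear_le hK hC hf.ennreal_ofReal
    hf₁.ennreal_ofReal hf₂.ennreal_ofReal).trans (by gcongr))
  rw [← lintegral_indicator (s := {q | _}) hR]
  refine lintegral_congr fun q => ?_
  by_cases hq : q ∈ resonantRegion α
  · rw [indicator_of_mem hq, indicator_of_mem (show q ∈ {q | _} from hq),
      ← ENNReal.ofReal_mul (by unfold multiplier; positivity),
      ← ENNReal.ofReal_mul (hf₁0 _), ← ENNReal.ofReal_mul
        (mul_nonneg (by unfold multiplier; positivity) (hf0 _))]
    congr 1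
    simp only [multiplier]
    ring
  · rw [indicator_of_notMem hq, indicator_of_notMem (show q ∉ {q | _} from hq), zero_mul, zero_mul]
end
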